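/- Let f : (X,r) → (Y,s) be an epimorphism (surjective homomorphism) of non-degenerate solutions, and let f̄ : G_X → G_Y be the induced skew brace homomorphism between the structure skew braces. Then Ker f̄ is the ideal of G_X generated by the set K = { ι(x)⁻¹·ι(y) : x, y ∈ X with f(x) = f(y) }. -/

import Mathlib

/-!
Common definitions: skew braces, set-theoretic solutions of the Yang–Baxter
equation, structure skew braces, ideals, i-homomorphisms, solubility.
-/

universe u v

/-- A skew (left) brace: two group structures `(B,+)` and `(B,·)` sharing the
same identity `0`, with `a·(b+c) = a·b − a + a·c`. -/
structure SkewBrace (B : Type u) where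
  add : B → B → B
  zero : B
  neg : B → B
  mul : B → B → B
  inv : B → B
  add_assoc : ∀ a b c, add (add a b) c = add a (add b c)
  zero_add : ∀ a, add zero a = a
  add_zero : ∀ a, add a zero = a
  neg_add : ∀ a, add (neg a) a = zero
  add_neg : ∀ a, add a (neg a) = zero
  mul_assoc : ∀ a b c, mul (mul a b) c = mul a (mul b c)
  zero_mul : ∀ a, mul zero a = a
  mul_zero : ∀ a, mul a zero = a
  inv_mul : ∀ a, mul (inv a) a = zero
  mul_inv : ∀ a, mul a (inv a) = zero
  compat : ∀ a b c, mul a (add b c) = add (add (mul a b) (neg a)) (mul a c)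

namespace SkewBrace

variable {B : Type u} (S : SkewBrace B)

/-- `λ_a(b) = −a + a·b`. -/
def lam (a b : B) : B := S.add (S.neg a) (S.mul a b)

/-- `ρ_b(a) = λ_a(b)⁻¹ · a · b`. -/
def rho (b a : B) : B := S.mul (S.mul (S.inv (S.lam a b)) a) b

/-- The solution of the YBE associated with a skew brace:
`r_B(a,b) = (λ_a(b), ρ_b(a))`. -/
def rB : B × B → B × B := fun p => (S.lam p.1 p.2, S.rho p.2 p.1)

end SkewBrace

/-- Homomorphism of skew braces: preserves both operations. -/
def IsHom {B : Type u} {C : Type v} (S : SkewBrace B) (T : SkewBrace C) (f : B → C) : Prop :=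
  (∀ a b, f (S.add a b) = T.add (f a) (f b)) ∧ (∀ a b, f (S.mul a b) = T.mul (f a) (f b))

/-- The kernel of a skew brace homomorphism: preimage of `0`. -/
def brKer {B : Type u} {C : Type v} (T : SkewBrace C) (f : B → C) : Set B :=
  {a | f a = T.zero}

/-- An ideal of a skew brace: a sub-skew brace, normal in both `(B,+)` and `(B,·)`,
and `λ_b`-invariant for all `b`. -/
def IsIdeal {B : Type u} (S : SkewBrace B) (I : Set B) : Prop :=
  S.zero ∈ I ∧
  (∀ a ∈ I, ∀ b ∈ I, S.add a b ∈ I) ∧ (∀ a ∈ I, S.neg a ∈ I) ∧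
  (∀ a ∈ I, ∀ b ∈ I, S.mul a b ∈ I) ∧ (∀ a ∈ I, S.inv a ∈ I) ∧
  (∀ b : B, ∀ a ∈ I, S.add (S.add b a) (S.neg b) ∈ I) ∧
  (∀ b : B, ∀ a ∈ I, S.mul (S.mul b a) (S.inv b) ∈ I) ∧
  (∀ b : B, S.lam b '' I = I)

/-- A skew brace is simple if it is non-trivial and its only ideals are `{0}` and `B`. -/
def IsSimpleBrace {B : Type u} (S : SkewBrace B) : Prop :=
  (∃ a : B, a ≠ S.zero) ∧
  ∀ I : Set B, IsIdeal S I → I = {S.zero} ∨ I = Set.univ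

/-- The socle of a skew brace: elements `a` with `λ_a = id` commuting additively
with everything. -/
def Soc {B : Type u} (S : SkewBrace B) : Set B :=
  {a | (∀ b, S.lam a b = b) ∧ (∀ b, S.add a b = S.add b a)}

/-- `r × id` on triples. -/
def rOne {X : Type u} (r : X × X → X × X) : X × X × X → X × X × X :=
  fun p => ((r (p.1, p.2.1)).1, (r (p.1, p.2.1)).2, p.2.2)

/-- `id × r` on triples. -/
def rTwo {X : Type u} (r : X × X → X × X) : X × X × X → X × X × X :=
  fun p => (p.1, r p.2)

/-- `(X,r)` is a set-theoretic solution of the Yang–Baxter equation. -/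
def IsSolution {X : Type u} (r : X × X → X × X) : Prop :=
  Function.Bijective r ∧
  rOne r ∘ rTwo r ∘ rOne r = rTwo r ∘ rOne r ∘ rTwo r

/-- `λ_x(y)` for a solution, i.e. the first component of `r(x,y)`. -/
def lamMap {X : Type u} (r : X × X → X × X) (x : X) : X → X := fun y => (r (x, y)).1

/-- `ρ_y(x)` for a solution, i.e. the second component of `r(x,y)`. -/
def rhoMap {X : Type u} (r : X × X → X × X) (y : X) : X → X := fun x => (r (x, y)).2

/-- Non-degeneracy: all `λ_x` and `ρ_y` are bijective. -/
def Nondeg {X : Type u} (r : X × X → X × X) : Prop :=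
  (∀ x, Function.Bijective (lamMap r x)) ∧ (∀ y, Function.Bijective (rhoMap r y))

/-- Homomorphism of solutions: `(f×f)∘r = s∘(f×f)`. -/
def IsSolHom {X : Type u} {Y : Type v} (r : X × X → X × X) (s : Y × Y → Y × Y)
    (f : X → Y) : Prop :=
  Prod.map f f ∘ r = s ∘ Prod.map f f

/-- The structure skew brace `(G_X, ι)` of a solution `(X,r)`: the image of `ι`
generates `(G_X,·)`, `ι` intertwines `r` with `r_{G_X}`, and the pair has the
universal property for maps into skew braces. -/
structure StructureBrace {X : Type u} (r : X × X → X × X) where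
  G : Type u
  S : SkewBrace G
  ι : X → G
  gen : ∀ H : Set G, S.zero ∈ H → (∀ a ∈ H, ∀ b ∈ H, S.mul a b ∈ H) →
      (∀ a ∈ H, S.inv a ∈ H) → Set.range ι ⊆ H → H = Set.univ
  compat : Prod.map ι ι ∘ r = S.rB ∘ Prod.map ι ι
  univ : ∀ {C : Type u} (T : SkewBrace C) (g : X → C),
      Prod.map g g ∘ r = T.rB ∘ Prod.map g g →
      ∃! h : G → C, IsHom S T h ∧ h ∘ ι = g

/-- The multiplicative subgroup (as a set) generated by a subset. -/
def mulClosure {B : Type u} (S : SkewBrace B) (A : Set B) : Set B :=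
  ⋂₀ {H : Set B | S.zero ∈ H ∧ (∀ a ∈ H, ∀ b ∈ H, S.mul a b ∈ H) ∧
      (∀ a ∈ H, S.inv a ∈ H) ∧ A ⊆ H}

/-- The additive subgroup (as a set) generated by a subset. -/
def addClosure {B : Type u} (S : SkewBrace B) (A : Set B) : Set B :=
  ⋂₀ {H : Set B | S.zero ∈ H ∧ (∀ a ∈ H, ∀ b ∈ H, S.add a b ∈ H) ∧
      (∀ a ∈ H, S.neg a ∈ H) ∧ A ⊆ H}

/-- The ideal generated by a subset: intersection of all ideals containing it. -/
def idealClosure {B : Type u} (S : SkewBrace B) (A : Set B) : Set B :=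
  ⋂₀ {I : Set B | IsIdeal S I ∧ A ⊆ I}

/-- Product of two subsets in the multiplicative group. -/
def setMul {B : Type u} (S : SkewBrace B) (A₁ A₂ : Set B) : Set B :=
  {c | ∃ a ∈ A₁, ∃ b ∈ A₂, c = S.mul a b}

/-- Sum of two subsets in the additive group. -/
def setAdd {B : Type u} (S : SkewBrace B) (A₁ A₂ : Set B) : Set B :=
  {c | ∃ a ∈ A₁, ∃ b ∈ A₂, c = S.add a b}

/-- The multiplicative left coset `a·I`. -/
def lCoset {B : Type u} (S : SkewBrace B) (a : B) (I : Set B) : Set B :=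
  (fun w => S.mul a w) '' I

/-- Equivalence class of the kernel relation of a map. -/
def kerClass {X : Type u} {Y : Type v} (f : X → Y) (x : X) : Set X := {z | f z = f x}

/-- `X₀` is an i-kernel of the homomorphism of solutions `f : (X,r) → (Y,s)`:
`f` is a homomorphism of solutions, `X₀` is an equivalence class of `ker f`, and
for every class `Z` of `ker f`, `r(X₀ × Z) = Z × X₀` and `r(Z × X₀) = X₀ × Z`.
A homomorphism admitting such a class is an i-homomorphism. -/
def IsIKernel {X : Type u} {Y : Type v} (r : X × X → X × X) (s : Y × Y → Y × Y)
    (f : X → Y) (X₀ : Set X) : Prop :=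
  IsSolHom r s f ∧ (∃ x : X, X₀ = kerClass f x) ∧
  ∀ z : X, r '' (X₀ ×ˢ kerClass f z) = (kerClass f z) ×ˢ X₀ ∧
           r '' ((kerClass f z) ×ˢ X₀) = X₀ ×ˢ (kerClass f z)

/-- A strong left ideal: a `λ`-invariant subgroup of `(B,+)` which is normal
in `(B,+)`. -/
def IsStrongLeftIdeal {B : Type u} (S : SkewBrace B) (I : Set B) : Prop :=
  S.zero ∈ I ∧ (∀ a ∈ I, ∀ b ∈ I, S.add a b ∈ I) ∧ (∀ a ∈ I, S.neg a ∈ I) ∧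
  (∀ b : B, S.lam b '' I = I) ∧
  (∀ b : B, ∀ a ∈ I, S.add (S.add b a) (S.neg b) ∈ I)

/-- An abelian ideal: an ideal on which the two operations coincide and are
commutative (so it is an abelian/trivial skew brace). -/
def IsAbelianIdeal {C : Type u} (T : SkewBrace C) (J : Set C) : Prop :=
  IsIdeal T J ∧ ∀ a ∈ J, ∀ b ∈ J, T.mul a b = T.add a b ∧ T.add a b = T.add b a

/-- Solubility of a skew brace: epimorphisms `f_k : B → B_k`, `0 ≤ k ≤ t`, with
`Ker f_t = 0 ⊆ … ⊆ Ker f_0 = B` and `f_k(Ker f_{k−1})` an abelian ideal of `B_k`. -/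
def IsSoluble {B : Type u} (S : SkewBrace B) : Prop :=
  ∃ (t : ℕ) (C : Fin (t + 1) → Type u) (T : ∀ k, SkewBrace (C k)) (f : ∀ k, B → C k),
    (∀ k, IsHom S (T k) (f k) ∧ Function.Surjective (f k)) ∧
    brKer (T (Fin.last t)) (f (Fin.last t)) = {S.zero} ∧
    brKer (T 0) (f 0) = Set.univ ∧
    (∀ k : Fin t, brKer (T k.succ) (f k.succ) ⊆ brKer (T k.castSucc) (f k.castSucc)) ∧
    (∀ k : Fin t, IsAbelianIdeal (T k.succ) (f k.succ '' brKer (T k.castSucc) (f k.castSucc)))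

/-- Solubility of a solution `(X,r)` (with structure skew brace `(G_X, ι)`):
there are skew braces `B_0,…,B_t`, i-epimorphisms `f_k : (X,r) → (B_k, r_{B_k})`
with i-kernels `X_k` for `0 ≤ k ≤ t−1`, and an epimorphism `f_t`, such that
`ker f_k ⊆ ker f_{k−1}`, `ker f_0` is total, `ker f_t ⊆ ker ι`, and each
`f_k(X_{k−1})` lies in an abelian ideal `J` of `B_k` with `f_k(x)·J = f_k(y)·J`
whenever `x (ker f_{k−1}) y`. -/
def IsSolubleSolution {X : Type u} (r : X × X → X × X) (GX : StructureBrace r) : Prop :=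
  ∃ (t : ℕ) (C : Fin (t + 1) → Type u) (T : ∀ k, SkewBrace (C k))
    (f : ∀ k : Fin (t + 1), X → C k) (Xk : Fin t → Set X),
    (∀ k : Fin (t + 1), IsSolHom r (T k).rB (f k) ∧ Function.Surjective (f k)) ∧
    (∀ k : Fin t, IsIKernel r (T k.castSucc).rB (f k.castSucc) (Xk k)) ∧
    (∀ x y : X, f 0 x = f 0 y) ∧
    (∀ k : Fin t, ∀ x y : X, f k.succ x = f k.succ y → f k.castSucc x = f k.castSucc y) ∧
    (∀ x y : X, f (Fin.last t) x = f (Fin.last t) y → GX.ι x = GX.ι y) ∧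
    (∀ k : Fin t, ∃ J : Set (C k.succ), IsAbelianIdeal (T k.succ) J ∧
      f k.succ '' (Xk k) ⊆ J ∧
      ∀ x y : X, f k.castSucc x = f k.castSucc y →
        lCoset (T k.succ) (f k.succ x) J = lCoset (T k.succ) (f k.succ y) J)

/-- Decomposability of a solution: `X = Y ∪ Z` with `Y, Z` proper and
`r(Y×Y) = Y×Y`, `r(Z×Z) = Z×Z`. -/
def Decomposable {X : Type u} (r : X × X → X × X) : Prop :=
  ∃ Y Z : Set X, Y ≠ Set.univ ∧ Z ≠ Set.univ ∧ Y ∪ Z = Set.univ ∧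
    r '' (Y ×ˢ Y) = Y ×ˢ Y ∧ r '' (Z ×ˢ Z) = Z ×ˢ Z

namespace SkewBrace

variable {B : Type u} (S : SkewBrace B)

/-- The multiplicative group of a skew brace. -/
abbrev mulGroup : Group B where
  mul := S.mul
  one := S.zero
  inv := S.inv
  mul_assoc := S.mul_assoc
  one_mul := S.zero_mul
  mul_one := S.mul_zero
  inv_mul_cancel := S.inv_mul

/-- The additive group of a skew brace. -/
abbrev addGroup : AddGroup B where
  add := S.add
  zero := S.zero
  neg := S.neg
  add_assoc := S.add_assoc
  zero_add := S.zero_add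
  add_zero := S.add_zero
  neg_add_cancel := S.neg_add
  nsmul := letI : Zero B := ⟨S.zero⟩; letI : Add B := ⟨S.add⟩; nsmulRec
  zsmul := letI : Zero B := ⟨S.zero⟩; letI : Add B := ⟨S.add⟩; letI : Neg B := ⟨S.neg⟩; zsmulRec

theorem mul_inv_mul (a b : B) : S.mul a (S.mul (S.inv a) b) = b := by
  rw [← S.mul_assoc, S.mul_inv, S.zero_mul]

theorem inv_mul_mul (a b : B) : S.mul (S.inv a) (S.mul a b) = b := by
  rw [← S.mul_assoc, S.inv_mul, S.zero_mul]

theorem add_neg_add (a b : B) : S.add a (S.add (S.neg a) b) = b := by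
  rw [← S.add_assoc, S.add_neg, S.zero_add]

theorem neg_add_add (a b : B) : S.add (S.neg a) (S.add a b) = b := by
  rw [← S.add_assoc, S.neg_add, S.zero_add]

theorem lam_inv_mul (a b : B) : S.lam a (S.mul (S.inv a) b) = S.add (S.neg a) b := by
  rw [lam, mul_inv_mul]

theorem lam_injective (a : B) : Function.Injective (S.lam a) := by
  intro b c h
  have h₁ := congrArg (S.add a) h
  simp only [lam, add_neg_add] at h₁
  rw [← S.inv_mul_mul a b, h₁, inv_mul_mul]

theorem lam_inv_mul_add (a b : B) : S.lam a (S.mul (S.inv a) (S.add a b)) = b := by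
  rw [lam_inv_mul, neg_add_add]

end SkewBrace

namespace IsHom

variable {B : Type u} {C : Type v} {S : SkewBrace B} {T : SkewBrace C} {h : B → C}

theorem map_zero (hh : IsHom S T h) : h S.zero = T.zero := by
  have h₁ := hh.1 S.zero S.zero
  rw [S.zero_add] at h₁
  rw [← T.neg_add_add (h S.zero) (h S.zero), ← h₁, T.neg_add]

theorem map_neg (hh : IsHom S T h) (a : B) : h (S.neg a) = T.neg (h a) := by
  rw [← T.neg_add_add (h a) (h (S.neg a)), ← hh.1, S.add_neg, hh.map_zero, T.add_zero]

theorem map_inv (hh : IsHom S T h) (a : B) : h (S.inv a) = T.inv (h a) := by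
  rw [← T.inv_mul_mul (h a) (h (S.inv a)), ← hh.2, S.mul_inv, hh.map_zero, T.mul_zero]

theorem map_lam (hh : IsHom S T h) (a b : B) : h (S.lam a b) = T.lam (h a) (h b) := by
  simp only [SkewBrace.lam, hh.1, hh.2, hh.map_neg]

theorem map_rB (hh : IsHom S T h) (p : B × B) :
    Prod.map h h (S.rB p) = T.rB (Prod.map h h p) := by
  simp only [SkewBrace.rB, SkewBrace.rho, Prod.map, hh.2, hh.map_inv, hh.map_lam]

theorem comp {D : Type*} {U : SkewBrace D} {k : C → D} (hk : IsHom T U k) (hh : IsHom S T h) :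
    IsHom S U (k ∘ h) :=
  ⟨fun a b => by simp only [Function.comp_apply, hh.1, hk.1],
   fun a b => by simp only [Function.comp_apply, hh.2, hk.2]⟩

theorem isIdeal_brKer (hh : IsHom S T h) : IsIdeal S (brKer T h) := by
  have neg_zero : T.neg T.zero = T.zero := by
    rw [← T.zero_add (T.neg T.zero), T.add_neg]
  have inv_zero : T.inv T.zero = T.zero := by
    rw [← T.zero_mul (T.inv T.zero), T.mul_inv]
  simp only [IsIdeal, brKer, Set.mem_ofPred_eq]
  refine ⟨hh.map_zero, ?_, ?_, ?_, ?_, ?_, ?_, ?_⟩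
  · intro a ha b hb
    rw [hh.1, ha, hb, T.zero_add]
  · intro a ha
    rw [hh.map_neg, ha, neg_zero]
  · intro a ha b hb
    rw [hh.2, ha, hb, T.zero_mul]
  · intro a ha
    rw [hh.map_inv, ha, inv_zero]
  · intro b a ha
    rw [hh.1, hh.1, hh.map_neg, ha, T.add_zero, T.add_neg]
  · intro b a ha
    rw [hh.2, hh.2, hh.map_inv, ha, T.mul_zero, T.mul_inv]
  · intro b
    ext a
    constructor
    · rintro ⟨c, hc, rfl⟩
      rw [Set.mem_ofPred_eq] at hc ⊢
      rw [hh.map_lam, hc, SkewBrace.lam, T.mul_zero, T.neg_add]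
    · intro ha
      rw [Set.mem_ofPred_eq] at ha
      refine ⟨S.mul (S.inv b) (S.add b a), ?_, S.lam_inv_mul_add b a⟩
      rw [Set.mem_ofPred_eq, hh.2, hh.1, hh.map_inv, ha, T.add_zero, T.inv_mul]

end IsHom

namespace IsIdeal

variable {B : Type u} {S : SkewBrace B} {I : Set B}

theorem inv_mul_mem_iff (hI : IsIdeal S I) (a b : B) :
    S.mul (S.inv a) b ∈ I ↔ S.add (S.neg a) b ∈ I := by
  obtain ⟨-, -, -, -, -, -, -, hlam⟩ := hI
  rw [← S.lam_inv_mul]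
  nth_rewrite 2 [← hlam a]
  exact (S.lam_injective a).mem_set_image.symm

/-- An ideal as a congruence of the multiplicative group. -/
def con (hI : IsIdeal S I) : @Con B S.mulGroup.toMul :=
  letI := S.mulGroup
  let N : Subgroup B :=
    { carrier := I
      mul_mem' := fun {a b} ha hb => hI.2.2.2.1 a ha b hb
      one_mem' := hI.1
      inv_mem' := fun {a} ha => hI.2.2.2.2.1 a ha }
  haveI : N.Normal := ⟨fun a ha b => hI.2.2.2.2.2.2.1 b a ha⟩
  QuotientGroup.con N

/-- An ideal as a congruence of the additive group. -/
def addCon (hI : IsIdeal S I) : @AddCon B S.addGroup.toAdd :=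
  letI := S.addGroup
  let N : AddSubgroup B :=
    { carrier := I
      add_mem' := fun {a b} ha hb => hI.2.1 a ha b hb
      zero_mem' := hI.1
      neg_mem' := fun {a} ha => hI.2.2.1 a ha }
  haveI : N.Normal := ⟨fun a ha b => hI.2.2.2.2.2.1 b a ha⟩
  QuotientAddGroup.con N

theorem con_iff (hI : IsIdeal S I) (a b : B) : hI.con.r a b ↔ S.mul (S.inv a) b ∈ I :=
  @QuotientGroup.leftRel_apply B S.mulGroup _ a b

theorem addCon_iff (hI : IsIdeal S I) (a b : B) : hI.addCon.r a b ↔ S.add (S.neg a) b ∈ I :=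
  @QuotientAddGroup.leftRel_apply B S.addGroup _ a b

theorem con_iff_addCon (hI : IsIdeal S I) (a b : B) : hI.con.r a b ↔ hI.addCon.r a b := by
  rw [con_iff, addCon_iff, inv_mul_mem_iff hI]

/-- The underlying type of the quotient of a skew brace by an ideal. -/
def Quot (hI : IsIdeal S I) : Type u :=
  letI := S.mulGroup
  Quotient hI.con.toSetoid

/-- The projection onto the quotient by an ideal. -/
def mk (hI : IsIdeal S I) (a : B) : hI.Quot := Quotient.mk _ a

theorem mk_eq_mk (hI : IsIdeal S I) {a b : B} : hI.mk a = hI.mk b ↔ S.mul (S.inv a) b ∈ I :=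
  Quotient.eq.trans (hI.con_iff a b)

/-- The quotient of a skew brace by an ideal. -/
def quotient (hI : IsIdeal S I) : SkewBrace hI.Quot where
  add := Quotient.map₂ S.add fun a b hab c d hcd =>
    (hI.con_iff_addCon _ _).2 <| letI := S.addGroup
      hI.addCon.add ((hI.con_iff_addCon a b).1 hab) ((hI.con_iff_addCon c d).1 hcd)
  zero := hI.mk S.zero
  neg := Quotient.map S.neg fun a b hab =>
    (hI.con_iff_addCon _ _).2 <| letI := S.addGroup
      hI.addCon.neg ((hI.con_iff_addCon a b).1 hab)
  mul := Quotient.map₂ S.mul fun _ _ hab _ _ hcd => letI := S.mulGroup; hI.con.mul hab hcd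
  inv := Quotient.map S.inv fun _ _ hab => letI := S.mulGroup; hI.con.inv hab
  add_assoc := by rintro ⟨a⟩ ⟨b⟩ ⟨c⟩; exact congrArg hI.mk (S.add_assoc a b c)
  zero_add := by rintro ⟨a⟩; exact congrArg hI.mk (S.zero_add a)
  add_zero := by rintro ⟨a⟩; exact congrArg hI.mk (S.add_zero a)
  neg_add := by rintro ⟨a⟩; exact congrArg hI.mk (S.neg_add a)
  add_neg := by rintro ⟨a⟩; exact congrArg hI.mk (S.add_neg a)
  mul_assoc := by rintro ⟨a⟩ ⟨b⟩ ⟨c⟩; exact congrArg hI.mk (S.mul_assoc a b c)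
  zero_mul := by rintro ⟨a⟩; exact congrArg hI.mk (S.zero_mul a)
  mul_zero := by rintro ⟨a⟩; exact congrArg hI.mk (S.mul_zero a)
  inv_mul := by rintro ⟨a⟩; exact congrArg hI.mk (S.inv_mul a)
  mul_inv := by rintro ⟨a⟩; exact congrArg hI.mk (S.mul_inv a)
  compat := by rintro ⟨a⟩ ⟨b⟩ ⟨c⟩; exact congrArg hI.mk (S.compat a b c)

theorem isHom_mk (hI : IsIdeal S I) : IsHom S hI.quotient hI.mk :=
  ⟨fun _ _ => rfl, fun _ _ => rfl⟩

theorem brKer_mk (hI : IsIdeal S I) : brKer hI.quotient hI.mk ⊆ I := by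
  intro a ha
  have h₁ : S.mul (S.inv S.zero) a ∈ I := hI.mk_eq_mk.1 (Eq.symm ha)
  have inv_zero : S.inv S.zero = S.zero := by
    rw [← S.zero_mul (S.inv S.zero), S.mul_inv]
  rwa [inv_zero, S.zero_mul] at h₁

end IsIdeal

namespace StructureBrace

variable {X : Type u} {r : X × X → X × X}

theorem hom_ext (GX : StructureBrace r) {C : Type u} {T : SkewBrace C} {h k : GX.G → C}
    (hh : IsHom GX.S T h) (hk : IsHom GX.S T k) (hhk : h ∘ GX.ι = k ∘ GX.ι) : h = k := by
  refine (GX.univ T (k ∘ GX.ι) ?_).unique ⟨hh, hhk⟩ ⟨hk, rfl⟩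
  funext p
  have h₁ := congrFun GX.compat p
  simp only [Function.comp_apply] at h₁ ⊢
  rw [← Prod.map_map, h₁, hk.map_rB, ← Prod.map_map]

/-- A skew brace homomorphism out of the structure skew brace of `X` which is constant on
the fibres of an epimorphism `f : X → Y` factors through the structure skew brace of `Y`. -/
theorem exists_factor {Y : Type u} {s : Y × Y → Y × Y} {f : X → Y} (hf : IsSolHom r s f)
    (hfs : Function.Surjective f) (GX : StructureBrace r) (GY : StructureBrace s)
    {fbar : GX.G → GY.G} (hfb : IsHom GX.S GY.S fbar) (hcomm : fbar ∘ GX.ι = GY.ι ∘ f)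
    {C : Type u} {T : SkewBrace C} {p : GX.G → C} (hp : IsHom GX.S T p)
    (hpf : ∀ x y, f x = f y → p (GX.ι x) = p (GX.ι y)) :
    ∃ h : GY.G → C, IsHom GY.S T h ∧ h ∘ fbar = p := by
  obtain ⟨g, hg⟩ : ∃ g : Y → C, g ∘ f = p ∘ GX.ι :=
    ⟨fun y => p (GX.ι (Function.surjInv hfs y)), funext fun x =>
      hpf _ _ (Function.surjInv_eq hfs (f x))⟩
  obtain ⟨h, ⟨hh, hhg⟩, -⟩ := GY.univ T g <| by
    refine (hfs.prodMap hfs).injective_comp_right ?_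
    have hf' : Prod.map f f ∘ r = s ∘ Prod.map f f := hf
    have hp' : Prod.map p p ∘ GX.S.rB = T.rB ∘ Prod.map p p := funext hp.map_rB
    change (Prod.map g g ∘ s) ∘ Prod.map f f = (T.rB ∘ Prod.map g g) ∘ Prod.map f f
    rw [Function.comp_assoc, ← hf', ← Function.comp_assoc, Prod.map_comp_map, hg,
      Function.comp_assoc, Prod.map_comp_map, hg, ← Prod.map_comp_map,
      Function.comp_assoc, GX.compat, ← Function.comp_assoc, hp', Function.comp_assoc]
  refine ⟨h, hh, GX.hom_ext (hh.comp hfb) hp ?_⟩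
  rw [Function.comp_assoc, hcomm, ← Function.comp_assoc, hhg, hg]

end StructureBrace

/-- For an epimorphism `f` of non-degenerate solutions with induced
skew brace homomorphism `f̄ : G_X → G_Y`, `Ker f̄` is the ideal of `G_X`
generated by `K = {ι(x)⁻¹·ι(y) : f(x) = f(y)}`. -/
theorem stmt_4 {X Y : Type u} (r : X × X → X × X) (s : Y × Y → Y × Y)
    (hr : IsSolution r) (hrn : Nondeg r) (hs : IsSolution s) (hsn : Nondeg s)
    (f : X → Y) (hf : IsSolHom r s f) (hfs : Function.Surjective f)
    (GX : StructureBrace r) (GY : StructureBrace s)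
    (fbar : GX.G → GY.G) (hfb : IsHom GX.S GY.S fbar)
    (hcomm : fbar ∘ GX.ι = GY.ι ∘ f) :
    brKer GY.S fbar =
      idealClosure GX.S
        {w | ∃ x y : X, f x = f y ∧ w = GX.S.mul (GX.S.inv (GX.ι x)) (GX.ι y)} := by
  apply Set.Subset.antisymm
  · rintro a ha I ⟨hI, hKI⟩
    obtain ⟨h, hh, hhp⟩ := StructureBrace.exists_factor hf hfs GX GY hfb hcomm hI.isHom_mk
      fun x y hxy => hI.mk_eq_mk.2 (hKI ⟨x, y, hxy, rfl⟩)
    refine hI.brKer_mk ?_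
    have ha' : fbar a = GY.S.zero := ha
    change hI.mk a = hI.quotient.zero
    rw [← hhp, Function.comp_apply, ha', hh.map_zero]
  · refine Set.sInter_subset_of_mem ⟨hfb.isIdeal_brKer, ?_⟩
    rintro _ ⟨x, y, hxy, rfl⟩
    have hι : ∀ z, fbar (GX.ι z) = GY.ι (f z) := congrFun hcomm
    change fbar _ = _
    rw [hfb.2, hfb.map_inv, hι, hι, hxy, GY.S.inv_mul]
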